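/- arXiv:2409.07395 — 2 statements merged into one kernel-verified Lean document; each statement's English description precedes it below -/
import Mathlib

section
/- Let n < p < ∞ and let Q₀ ⊂ ℝⁿ be a cube with |Q₀| = 1. There is a constant C = C(n,p) such that for every f ∈ L¹(Q₀), ess sup_{x ∈ Q₀} |f(x) − f_{Q₀}| ≤ C · ‖f‖_{𝒪ᵖ(Q₀)}. -/
open MeasureTheory Set
open scoped ENNReal Classical

noncomputable section

/-- The unit cube in `ℝⁿ` with lower-left corner `c`. -/
def unitCube (n : ℕ) (c : Fin n → ℝ) : Set (Fin n → ℝ) :=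
  Set.univ.pi fun i => Set.Ico (c i) (c i + 1)

/-- The dyadic subcube of generation `k` and index `j` (sidelength `2 ^ (-k)`)
of the unit cube with corner `c`; it is a genuine subcube when `∀ i, j i < 2 ^ k`. -/
def dsub (n : ℕ) (c : Fin n → ℝ) (k : ℕ) (j : Fin n → ℕ) : Set (Fin n → ℝ) :=
  Set.univ.pi fun i => Set.Ico (c i + (j i : ℝ) / 2 ^ k) (c i + ((j i : ℝ) + 1) / 2 ^ k)

/-- The mean oscillation `O(f,E) = ⨍_E |f - ⨍_E f|` (w.r.t. Lebesgue measure). -/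
def osc {n : ℕ} (f : (Fin n → ℝ) → ℝ) (E : Set (Fin n → ℝ)) : ℝ :=
  ⨍ x in E, |f x - ⨍ y in E, f y|

/-- The `p`-th power of the quasi-norm `‖f‖_{𝒪^p(Q₀)}`, where `Q₀` is the unit cube with
corner `c`:  `sup_{λ>0} λ^p ∑_{Q ∈ 𝒟(Q₀), O(f,Q) > λ} ℓ(Q)^{-p} |Q|`. -/
def OpNormPow (n : ℕ) (c : Fin n → ℝ) (p : ℝ) (f : (Fin n → ℝ) → ℝ) : ℝ≥0∞ :=
  ⨆ l ∈ Set.Ioi (0 : ℝ), ENNReal.ofReal (l ^ p) *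
    ∑' (k : ℕ) (j : Fin n → ℕ),
      if (∀ i, j i < 2 ^ k) ∧ l < osc f (dsub n c k j) then
        ENNReal.ofReal (((2 : ℝ) ^ (-(k : ℤ))) ^ (-p)) * volume (dsub n c k j) else 0

lemma measurableSet_dsub (n : ℕ) (c : Fin n → ℝ) (k : ℕ) (j : Fin n → ℕ) :
    MeasurableSet (dsub n c k j) :=
  MeasurableSet.univ_pi fun _ => measurableSet_Ico

lemma volume_dsub (n : ℕ) (c : Fin n → ℝ) (k : ℕ) (j : Fin n → ℕ) :
    volume (dsub n c k j) = ENNReal.ofReal (((2 ^ k)⁻¹ : ℝ) ^ n) := by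
  have h (i : Fin n) : c i + ((j i : ℝ) + 1) / 2 ^ k - (c i + (j i : ℝ) / 2 ^ k)
      = (2 ^ k)⁻¹ := by
    field_simp
    ring
  rw [dsub, volume_pi_pi]
  simp only [Real.volume_Ico, h, Finset.prod_const, Finset.card_univ, Fintype.card_fin]
  rw [ENNReal.ofReal_pow (by positivity)]

lemma measureReal_dsub (n : ℕ) (c : Fin n → ℝ) (k : ℕ) (j : Fin n → ℕ) :
    volume.real (dsub n c k j) = ((2 ^ k)⁻¹ : ℝ) ^ n := by
  rw [measureReal_def, volume_dsub, ENNReal.toReal_ofReal (by positivity)]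

lemma dsub_zero (n : ℕ) (c : Fin n → ℝ) : dsub n c 0 0 = unitCube n c := by
  simp [dsub, unitCube]

lemma dsub_subset_unitCube {n : ℕ} (c : Fin n → ℝ) {k : ℕ} {j : Fin n → ℕ}
    (hj : ∀ i, j i < 2 ^ k) : dsub n c k j ⊆ unitCube n c := by
  refine Set.pi_mono fun i _ => Set.Ico_subset_Ico ?_ ?_
  · have : (0 : ℝ) ≤ (j i : ℝ) / 2 ^ k := by positivity
    linarith
  · have h : ((j i : ℝ) + 1) ≤ 2 ^ k := by exact_mod_cast hj i
    have : ((j i : ℝ) + 1) / 2 ^ k ≤ 1 := (div_le_one (by positivity)).2 h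
    linarith

/-- The index of the generation `k` dyadic cube containing `x`. -/
def dyadicIndex {n : ℕ} (c x : Fin n → ℝ) (k : ℕ) : Fin n → ℕ :=
  fun i => ⌊(x i - c i) * 2 ^ k⌋₊

lemma dyadicIndex_lt {n : ℕ} {c x : Fin n → ℝ} (hx : x ∈ unitCube n c) (k : ℕ) (i : Fin n) :
    dyadicIndex c x k i < 2 ^ k := by
  obtain ⟨h0, h1⟩ := hx i (Set.mem_univ i)
  have h2 : (0 : ℝ) < 2 ^ k := by positivity
  rw [dyadicIndex, Nat.floor_lt (mul_nonneg (by linarith) h2.le)]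
  push_cast
  nlinarith

lemma dyadicIndex_zero {n : ℕ} {c x : Fin n → ℝ} (hx : x ∈ unitCube n c) :
    dyadicIndex c x 0 = 0 := by
  funext i
  simpa using dyadicIndex_lt hx 0 i

lemma mem_dsub_dyadicIndex {n : ℕ} {c x : Fin n → ℝ} (hx : x ∈ unitCube n c) (k : ℕ) :
    x ∈ dsub n c k (dyadicIndex c x k) := by
  intro i _
  obtain ⟨h0, -⟩ := hx i (Set.mem_univ i)
  have h2 : (0 : ℝ) < 2 ^ k := by positivity
  have hle := Nat.floor_le (mul_nonneg (sub_nonneg.2 h0) h2.le)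
  have hlt := Nat.lt_floor_add_one ((x i - c i) * 2 ^ k)
  rw [← div_le_iff₀ h2] at hle
  rw [← lt_div_iff₀ h2] at hlt
  exact ⟨by simp only [dyadicIndex]; linarith, by simp only [dyadicIndex]; linarith⟩

lemma dsub_dyadicIndex_succ_subset {n : ℕ} {c x : Fin n → ℝ} (hx : x ∈ unitCube n c) (k : ℕ) :
    dsub n c (k + 1) (dyadicIndex c x (k + 1)) ⊆ dsub n c k (dyadicIndex c x k) := by
  refine Set.pi_mono fun i _ => ?_
  obtain ⟨h0, -⟩ := hx i (Set.mem_univ i)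
  have h2 : (0 : ℝ) < 2 ^ k := by positivity
  have ha : 0 ≤ (x i - c i) * 2 ^ k := mul_nonneg (sub_nonneg.2 h0) h2.le
  have heq : (x i - c i) * 2 ^ (k + 1) = 2 * ((x i - c i) * 2 ^ k) := by ring
  have hlow : 2 * dyadicIndex c x k i ≤ dyadicIndex c x (k + 1) i := by
    simp only [dyadicIndex, heq]
    refine Nat.le_floor ?_
    push_cast
    linarith [Nat.floor_le ha]
  have hupp : dyadicIndex c x (k + 1) i < 2 * dyadicIndex c x k i + 2 := by
    simp only [dyadicIndex, heq]
    rw [Nat.floor_lt (by linarith)]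
    push_cast
    linarith [Nat.lt_floor_add_one ((x i - c i) * 2 ^ k)]
  have hlow' : 2 * (dyadicIndex c x k i : ℝ) ≤ dyadicIndex c x (k + 1) i := by exact_mod_cast hlow
  have hupp' : (dyadicIndex c x (k + 1) i : ℝ) + 1 ≤ 2 * dyadicIndex c x k i + 2 := by
    exact_mod_cast hupp
  refine Set.Ico_subset_Ico ?_ ?_
  · refine add_le_add_right ?_ _
    rw [div_le_div_iff₀ h2 (by positivity), pow_succ]
    nlinarith
  · refine add_le_add_right ?_ _
    rw [div_le_div_iff₀ (by positivity) h2, pow_succ]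
    nlinarith

lemma closedBall_dsub_center (n : ℕ) (c : Fin n → ℝ) (k : ℕ) (j : Fin n → ℕ) :
    Metric.closedBall (fun i => c i + ((j i : ℝ) + 1 / 2) / 2 ^ k) (1 / 2 / 2 ^ k) =
      Set.univ.pi fun i => Set.Icc (c i + (j i : ℝ) / 2 ^ k) (c i + ((j i : ℝ) + 1) / 2 ^ k) := by
  rw [closedBall_pi _ (by positivity)]
  simp only [Real.closedBall_eq_Icc]
  congr! 3 <;> ring

lemma dsub_subset_closedBall (n : ℕ) (c : Fin n → ℝ) (k : ℕ) (j : Fin n → ℕ) :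
    dsub n c k j ⊆
      Metric.closedBall (fun i => c i + ((j i : ℝ) + 1 / 2) / 2 ^ k) (1 / 2 / 2 ^ k) := by
  rw [closedBall_dsub_center]
  exact Set.pi_mono fun i _ => Set.Ico_subset_Icc_self

lemma dsub_ae_eq_closedBall (n : ℕ) (c : Fin n → ℝ) (k : ℕ) (j : Fin n → ℕ) :
    dsub n c k j =ᵐ[volume]
      Metric.closedBall (fun i => c i + ((j i : ℝ) + 1 / 2) / 2 ^ k) (1 / 2 / 2 ^ k) := by
  rw [closedBall_dsub_center, Set.pi_univ_Icc]
  exact Measure.univ_pi_Ico_ae_eq_Icc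

lemma ae_tendsto_setAverage_dsub {n : ℕ} (c : Fin n → ℝ) {f : (Fin n → ℝ) → ℝ}
    (hf : IntegrableOn f (unitCube n c)) :
    ∀ᵐ x ∂volume.restrict (unitCube n c),
      Filter.Tendsto (fun k => ⨍ y in dsub n c k (dyadicIndex c x k), f y)
        Filter.atTop (nhds (f x)) := by
  have hm : MeasurableSet (unitCube n c) := MeasurableSet.univ_pi fun _ => measurableSet_Ico
  have hg : LocallyIntegrable ((unitCube n c).indicator f) volume :=
    (hf.integrable_indicator hm).locallyIntegrable
  rw [ae_restrict_iff' hm]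
  filter_upwards [IsUnifLocDoublingMeasure.ae_tendsto_average (μ := volume) hg 1] with x hx hxc
  have hr : Filter.Tendsto (fun k : ℕ => (1 / 2 / 2 ^ k : ℝ)) Filter.atTop
      (nhdsWithin 0 (Set.Ioi 0)) := by
    refine tendsto_nhdsWithin_iff.2 ⟨?_, Filter.Eventually.of_forall fun k => ?_⟩
    · have := (tendsto_pow_atTop_nhds_zero_of_lt_one (r := (1 / 2 : ℝ))
        (by norm_num) (by norm_num)).const_mul (1 / 2)
      simpa [div_eq_mul_inv] using this
    · exact Set.mem_Ioi.2 (by positivity)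
  have hlim := hx (fun k i => c i + ((dyadicIndex c x k i : ℝ) + 1 / 2) / 2 ^ k) _ hr
    (Filter.Eventually.of_forall fun k => by
      rw [one_mul]
      exact dsub_subset_closedBall n c k _ (mem_dsub_dyadicIndex hxc k))
  rw [Set.indicator_of_mem hxc] at hlim
  refine hlim.congr fun k => ?_
  rw [← setAverage_congr (dsub_ae_eq_closedBall n c k _)]
  refine setAverage_congr_fun (measurableSet_dsub n c k _) (.of_forall fun y hy => ?_)
  exact Set.indicator_of_mem (dsub_subset_unitCube c (dyadicIndex_lt hxc k) hy) f

lemma abs_setAverage_sub_le {α : Type*} [MeasurableSpace α] {μ : Measure α} {A B : Set α}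
    {f : α → ℝ} {K : ℝ} (hAB : A ⊆ B) (hA : 0 < μ.real A) (hB : μ B ≠ ∞)
    (hK : μ.real B ≤ K * μ.real A) (hf : IntegrableOn f B μ) (a : ℝ) :
    |⨍ x in A, f x ∂μ - a| ≤ K * ⨍ x in B, |f x - a| ∂μ := by
  have hA' : μ A ≠ ∞ := ne_top_of_le_ne_top hB (measure_mono hAB)
  have hB0 : 0 < μ.real B := hA.trans_le (measureReal_mono hAB hB)
  have hfa : IntegrableOn (fun x => f x - a) B μ := hf.sub (integrableOn_const hB)
  have hsub : ⨍ x in A, f x ∂μ - a = (μ.real A)⁻¹ * ∫ x in A, (f x - a) ∂μ := by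
    rw [integral_sub (hf.mono_set hAB) (integrableOn_const hA'), setIntegral_const, setAverage_eq]
    simp only [smul_eq_mul]
    field_simp
  rw [hsub, abs_mul, abs_of_pos (inv_pos.2 hA), setAverage_eq, smul_eq_mul]
  have h1 : |∫ x in A, (f x - a) ∂μ| ≤ ∫ x in B, |f x - a| ∂μ :=
    (abs_integral_le_integral_abs).trans
      (setIntegral_mono_set hfa.abs (.of_forall fun _ => abs_nonneg _) hAB.eventuallyLE)
  have h2 : (μ.real A)⁻¹ ≤ K * (μ.real B)⁻¹ := by
    rw [← div_eq_mul_inv, inv_eq_one_div, div_le_div_iff₀ hA hB0]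
    linarith
  rw [← mul_assoc]
  exact mul_le_mul h2 h1 (abs_nonneg _) ((inv_pos.2 hA).le.trans h2)

lemma ofReal_rpow_mul_le_OpNormPow {n : ℕ} (c : Fin n → ℝ) {p : ℝ} (f : (Fin n → ℝ) → ℝ)
    {k : ℕ} {j : Fin n → ℕ} (hj : ∀ i, j i < 2 ^ k) {l : ℝ} (hl : 0 < l)
    (hlo : l < osc f (dsub n c k j)) :
    ENNReal.ofReal (l ^ p * ((2 : ℝ) ^ (p - n)) ^ k) ≤ OpNormPow n c p f := by
  have hterm : ENNReal.ofReal (((2 : ℝ) ^ (p - n)) ^ k) =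
      ENNReal.ofReal (((2 : ℝ) ^ (-(k : ℤ))) ^ (-p)) * volume (dsub n c k j) := by
    rw [volume_dsub, ← ENNReal.ofReal_mul (by positivity)]
    congr 1
    rw [← Real.rpow_intCast, ← Real.rpow_mul (by norm_num), ← Real.rpow_natCast, ← Real.rpow_natCast,
      ← Real.rpow_natCast, ← Real.rpow_neg (by norm_num), ← Real.rpow_mul (by norm_num),
      ← Real.rpow_mul (by norm_num), ← Real.rpow_add (by norm_num)]
    congr 1
    push_cast
    ring
  refine le_trans ?_ (le_iSup₂_of_le l hl le_rfl)
  rw [ENNReal.ofReal_mul (by positivity), hterm]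
  gcongr
  refine le_trans ?_ (ENNReal.le_tsum k)
  refine le_trans ?_ (ENNReal.le_tsum j)
  rw [if_pos ⟨hj, hlo⟩]

lemma osc_dsub_le {n : ℕ} (c : Fin n → ℝ) {p : ℝ} (hp : 0 < p) (f : (Fin n → ℝ) → ℝ)
    (hN : OpNormPow n c p f ≠ ∞) {k : ℕ} {j : Fin n → ℕ} (hj : ∀ i, j i < 2 ^ k) :
    osc f (dsub n c k j) ≤
      (OpNormPow n c p f).toReal ^ (1 / p) * ((2 : ℝ) ^ (-(p - n) / p)) ^ k := by
  refine le_of_forall_lt_imp_le_of_dense fun l hlo => ?_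
  rcases le_or_gt l 0 with hl | hl
  · exact hl.trans (by positivity)
  have h := ENNReal.toReal_mono hN (ofReal_rpow_mul_le_OpNormPow c (p := p) f hj hl hlo)
  rw [ENNReal.toReal_ofReal (by positivity)] at h
  have h' := Real.rpow_le_rpow (by positivity) h (one_div_pos.2 hp).le
  have hw : (((2 : ℝ) ^ (p - n)) ^ k) ^ (1 / p) * ((2 : ℝ) ^ (-(p - n) / p)) ^ k = 1 := by
    rw [← Real.rpow_natCast, ← Real.rpow_natCast, ← Real.rpow_mul (by positivity),
      ← Real.rpow_mul (by norm_num), ← Real.rpow_mul (by norm_num), ← Real.rpow_add (by norm_num)]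
    convert Real.rpow_zero (2 : ℝ) using 2
    ring
  rw [Real.mul_rpow (by positivity) (by positivity), ← Real.rpow_mul hl.le,
    mul_one_div_cancel hp.ne', Real.rpow_one] at h'
  calc l = l * ((((2 : ℝ) ^ (p - n)) ^ k) ^ (1 / p) * ((2 : ℝ) ^ (-(p - n) / p)) ^ k) := by
        rw [hw, mul_one]
    _ = l * (((2 : ℝ) ^ (p - n)) ^ k) ^ (1 / p) * ((2 : ℝ) ^ (-(p - n) / p)) ^ k := by ring
    _ ≤ _ := by gcongr

/-- for `n < p < ∞` there is `C = C(n,p)` such that for every unit cube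
`Q₀ ⊂ ℝⁿ` and every `f ∈ L¹(Q₀)`,
`ess sup_{x ∈ Q₀} |f(x) - f_{Q₀}| ≤ C ‖f‖_{𝒪^p(Q₀)}`. -/
theorem statement3 (n : ℕ) (p : ℝ) (hp : (n : ℝ) < p) :
    ∃ C : ℝ, 0 < C ∧
      ∀ (c : Fin n → ℝ) (f : (Fin n → ℝ) → ℝ), IntegrableOn f (unitCube n c) →
      essSup (fun x => ENNReal.ofReal |f x - ⨍ y in unitCube n c, f y|)
          (volume.restrict (unitCube n c))
        ≤ ENNReal.ofReal C * (OpNormPow n c p f) ^ (1 / p) := by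
  have hp0 : 0 < p := (Nat.cast_nonneg n).trans_lt hp
  have hr1 : (2 : ℝ) ^ (-(p - n) / p) < 1 :=
    Real.rpow_lt_one_of_one_lt_of_neg (by norm_num) (div_neg_of_neg_of_pos (by linarith) hp0)
  have hC : 0 < 2 ^ n / (1 - (2 : ℝ) ^ (-(p - n) / p)) :=
    div_pos (by positivity) (sub_pos.2 hr1)
  refine ⟨_, hC, fun c f hf => ?_⟩
  by_cases hN : OpNormPow n c p f = ∞
  · rw [hN, ENNReal.top_rpow_of_pos (one_div_pos.2 hp0),
      ENNReal.mul_top (ENNReal.ofReal_pos.2 hC).ne']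
    exact le_top
  have hm : MeasurableSet (unitCube n c) := MeasurableSet.univ_pi fun _ => measurableSet_Ico
  refine essSup_le_of_ae_le _ ?_
  filter_upwards [ae_tendsto_setAverage_dsub c hf, ae_restrict_mem hm] with x hlim hx
  have hstep (k : ℕ) : dist (⨍ y in dsub n c k (dyadicIndex c x k), f y)
      (⨍ y in dsub n c (k + 1) (dyadicIndex c x (k + 1)), f y) ≤
      (2 ^ n * (OpNormPow n c p f).toReal ^ (1 / p)) * ((2 : ℝ) ^ (-(p - n) / p)) ^ k := by
    rw [dist_comm, Real.dist_eq, mul_assoc]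
    refine (abs_setAverage_sub_le (K := 2 ^ n) (dsub_dyadicIndex_succ_subset hx k) ?_ ?_ ?_
      (hf.mono_set (dsub_subset_unitCube c (dyadicIndex_lt hx k))) _).trans
      (mul_le_mul_of_nonneg_left (osc_dsub_le c hp0 f hN (dyadicIndex_lt hx k)) (by positivity))
    · rw [measureReal_dsub]
      positivity
    · rw [volume_dsub]
      exact ENNReal.ofReal_ne_top
    · rw [measureReal_dsub, measureReal_dsub, ← mul_pow, pow_succ, mul_inv]
      exact le_of_eq (by field_simp)
  have hdist := dist_le_of_le_geometric_of_tendsto₀ _ _ hr1 hstep hlim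
  rw [dyadicIndex_zero hx, dsub_zero, dist_comm, Real.dist_eq] at hdist
  refine (ENNReal.ofReal_le_ofReal hdist).trans_eq ?_
  rw [mul_div_right_comm, ENNReal.ofReal_mul hC.le,
    ← ENNReal.ofReal_rpow_of_nonneg ENNReal.toReal_nonneg (one_div_pos.2 hp0).le,
    ENNReal.ofReal_toReal hN]
end
end

section
/- Let μ be a Radon measure on ℝⁿ (a Borel measure finite on compact sets), let 1 ≤ p < ∞, let γ < 0, and let a = {a_Q}_{Q∈𝒟} be any sequence of real numbers indexed by the dyadic cubes. Then there is a constant C = C(n,γ) such that sup_{λ>0} λᵖ ∑_{Q∈𝒟 : |a_Q|>λ} ℓ(Q)^{−γ} μ(Q) ≤ C · sup_{λ>0} λᵖ sup_{𝒫} ∑_{Q∈𝒫 : |a_Q|>λ} ℓ(Q)^{−γ} μ(Q), where the inner supremum is over all collections 𝒫 ⊂ 𝒟 of pairwise disjoint dyadic cubes. -/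
open MeasureTheory Set
open scoped ENNReal Classical

noncomputable section

/-- The half-open dyadic cube in `ℝⁿ` of generation `k` (sidelength `2 ^ k`) and
corner index `j`, i.e. `∏ᵢ [jᵢ 2ᵏ, (jᵢ+1) 2ᵏ)`. -/
def dyadicCube (n : ℕ) (k : ℤ) (j : Fin n → ℤ) : Set (Fin n → ℝ) :=
  Set.univ.pi fun i => Set.Ico ((j i : ℝ) * 2 ^ k) (((j i : ℝ) + 1) * 2 ^ k)

theorem mem_dyadicCube_iff {n : ℕ} {k : ℤ} {j : Fin n → ℤ} {x : Fin n → ℝ} :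
    x ∈ dyadicCube n k j ↔ ∀ i, ⌊x i / (2 : ℝ) ^ k⌋ = j i := by
  have h2 : (0 : ℝ) < 2 ^ k := by positivity
  simp only [dyadicCube, Set.mem_univ_pi, Set.mem_Ico, Int.floor_eq_iff, le_div_iff₀ h2,
    div_lt_iff₀ h2]

theorem measurableSet_dyadicCube (n : ℕ) (k : ℤ) (j : Fin n → ℤ) :
    MeasurableSet (dyadicCube n k j) :=
  MeasurableSet.univ_pi fun _ => measurableSet_Ico

theorem floor_div_two_zpow_of_le {k k' : ℤ} (h : k ≤ k') (x : ℝ) :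
    ⌊x / (2 : ℝ) ^ k'⌋ = ⌊x / (2 : ℝ) ^ k⌋ / ((2 ^ (k' - k).toNat : ℕ) : ℤ) := by
  have hk : (2 : ℝ) ^ k' = 2 ^ k * ((2 ^ (k' - k).toNat : ℕ) : ℝ) := by
    rw [Nat.cast_pow, Nat.cast_ofNat, ← zpow_natCast, Int.toNat_of_nonneg (by lia),
      ← zpow_add₀ two_ne_zero]
    congr 1
    ring
  rw [hk, ← div_div, Int.floor_div_natCast]

/-- Two dyadic cubes are either disjoint, or the smaller is contained in the larger. -/
theorem dyadicCube_subset_of_not_disjoint {n : ℕ} {k k' : ℤ} {j j' : Fin n → ℤ} (h : k ≤ k')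
    (hd : ¬ Disjoint (dyadicCube n k j) (dyadicCube n k' j')) :
    dyadicCube n k j ⊆ dyadicCube n k' j' := by
  obtain ⟨x, hx, hx'⟩ := Set.not_disjoint_iff.1 hd
  intro y hy
  rw [mem_dyadicCube_iff] at *
  intro i
  rw [← hx' i, floor_div_two_zpow_of_le h, floor_div_two_zpow_of_le h, hx i, hy i]

theorem disjoint_dyadicCube_of_ne {n : ℕ} {k : ℤ} {j j' : Fin n → ℤ} (h : j ≠ j') :
    Disjoint (dyadicCube n k j) (dyadicCube n k j') := by
  rw [Set.disjoint_left]
  intro x hx hx'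
  rw [mem_dyadicCube_iff] at *
  exact h (funext fun i => (hx i).symm.trans (hx' i))

/-- The dyadic cubes of one generation contained in `A` have total measure at most `μ A`. -/
theorem tsum_measure_dyadicCube_subset_le {n : ℕ} (μ : Measure (Fin n → ℝ)) (k : ℤ)
    (A : Set (Fin n → ℝ)) :
    (∑' j : Fin n → ℤ, if dyadicCube n k j ⊆ A then μ (dyadicCube n k j) else 0) ≤ μ A := by
  have hS : ∀ j : Fin n → ℤ, (if dyadicCube n k j ⊆ A then dyadicCube n k j else ∅)
      ⊆ dyadicCube n k j := fun j => by split_ifs <;> simp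
  calc _ = ∑' j : Fin n → ℤ, μ (if dyadicCube n k j ⊆ A then dyadicCube n k j else ∅) :=
        tsum_congr fun j => by split_ifs <;> simp
    _ ≤ μ (⋃ j : Fin n → ℤ, if dyadicCube n k j ⊆ A then dyadicCube n k j else ∅) :=
        tsum_meas_le_meas_iUnion_of_disjoint μ
          (fun j => by split_ifs; exacts [measurableSet_dyadicCube n k j, .empty])
          (fun j j' h => (disjoint_dyadicCube_of_ne h).mono (hS j) (hS j'))
    _ ≤ μ A := measure_mono (Set.iUnion_subset fun j => by
        split_ifs with h; exacts [h, Set.empty_subset A])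

theorem tsum_zpow_two_rpow_eq {γ : ℝ} (hγ : γ < 0) (K : ℤ) :
    (∑' k : ℤ, if k ≤ K then ENNReal.ofReal (((2 : ℝ) ^ k) ^ (-γ)) else 0)
      = ENNReal.ofReal (1 - 2 ^ γ)⁻¹ * ENNReal.ofReal (((2 : ℝ) ^ K) ^ (-γ)) := by
  have hr : (2 : ℝ) ^ γ < 1 := Real.rpow_lt_one_of_one_lt_of_neg one_lt_two hγ
  have hinj : Function.Injective fun m : ℕ => K - (m : ℤ) := fun a b h => by
    simpa using h
  rw [← hinj.tsum_eq]
  · have hterm : ∀ m : ℕ, (if K - (m : ℤ) ≤ K then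
        ENNReal.ofReal (((2 : ℝ) ^ (K - (m : ℤ))) ^ (-γ)) else 0)
        = ENNReal.ofReal (2 ^ γ) ^ m * ENNReal.ofReal (((2 : ℝ) ^ K) ^ (-γ)) := fun m => by
      rw [if_pos (by lia), ← ENNReal.ofReal_pow (by positivity),
        ← ENNReal.ofReal_mul (by positivity), ← Real.rpow_intCast, ← Real.rpow_intCast,
        ← Real.rpow_natCast, ← Real.rpow_mul two_pos.le, ← Real.rpow_mul two_pos.le,
        ← Real.rpow_mul two_pos.le, ← Real.rpow_add two_pos]
      congr 2
      push_cast
      ring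
    rw [tsum_congr hterm, ENNReal.tsum_mul_right, ENNReal.tsum_geometric,
      ENNReal.ofReal_inv_of_pos (by linarith), ENNReal.ofReal_sub _ (by positivity),
      ENNReal.ofReal_one]
  · intro k hk
    have hk' : k ≤ K := by
      by_contra h
      simp [h] at hk
    exact ⟨(K - k).toNat, by simp only; lia⟩

/-- The geometric packing estimate: the weighted measures `ℓ(Q) ^ (-γ) * μ Q` of the dyadic
subcubes of a dyadic cube `M` sum to at most a constant times the weighted measure of `M`. -/
theorem tsum_dyadicCube_subset_le {n : ℕ} (μ : Measure (Fin n → ℝ)) {γ : ℝ} (hγ : γ < 0)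
    (M : ℤ × (Fin n → ℤ)) :
    (∑' Q : ℤ × (Fin n → ℤ),
      if Q.1 ≤ M.1 ∧ dyadicCube n Q.1 Q.2 ⊆ dyadicCube n M.1 M.2 then
        ENNReal.ofReal (((2 : ℝ) ^ Q.1) ^ (-γ)) * μ (dyadicCube n Q.1 Q.2) else 0)
      ≤ ENNReal.ofReal (1 - 2 ^ γ)⁻¹ *
        (ENNReal.ofReal (((2 : ℝ) ^ M.1) ^ (-γ)) * μ (dyadicCube n M.1 M.2)) := by
  rw [ENNReal.tsum_prod (f := fun k j =>
    if k ≤ M.1 ∧ dyadicCube n k j ⊆ dyadicCube n M.1 M.2 then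
      ENNReal.ofReal (((2 : ℝ) ^ k) ^ (-γ)) * μ (dyadicCube n k j) else 0), ← mul_assoc, ← tsum_zpow_two_rpow_eq hγ, ← ENNReal.tsum_mul_right]
  refine ENNReal.tsum_le_tsum fun k => ?_
  by_cases hk : k ≤ M.1
  · simp only [hk, true_and, if_true]
    calc _ = ENNReal.ofReal (((2 : ℝ) ^ k) ^ (-γ)) * ∑' j : Fin n → ℤ,
          if dyadicCube n k j ⊆ dyadicCube n M.1 M.2 then μ (dyadicCube n k j) else 0 := by
          simp only [← ENNReal.tsum_mul_left, mul_ite, mul_zero]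
      _ ≤ _ := by gcongr; exact tsum_measure_dyadicCube_subset_le μ k _
  · simp [hk]

/-- Every finite family of dyadic cubes has a pairwise disjoint subfamily (its maximal cubes)
whose members contain all the cubes of the family. -/
theorem exists_pairwiseDisjoint_dyadicCube_cover {n : ℕ} (F : Finset (ℤ × (Fin n → ℤ))) :
    ∃ P ⊆ F, (P : Set (ℤ × (Fin n → ℤ))).PairwiseDisjoint (fun Q => dyadicCube n Q.1 Q.2) ∧
      ∀ Q ∈ F, ∃ M ∈ P, Q.1 ≤ M.1 ∧ dyadicCube n Q.1 Q.2 ⊆ dyadicCube n M.1 M.2 := by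
  refine ⟨F.filter fun M => ∀ R ∈ F, M.1 < R.1 →
    Disjoint (dyadicCube n M.1 M.2) (dyadicCube n R.1 R.2), Finset.filter_subset _ _, ?_, ?_⟩
  · rintro ⟨k, j⟩ hM ⟨k', j'⟩ hM' hne
    simp only [Finset.coe_filter, Set.mem_ofPred_eq] at hM hM'
    rcases lt_trichotomy k k' with h | rfl | h
    · exact hM.2 _ hM'.1 h
    · exact disjoint_dyadicCube_of_ne fun h => hne (Prod.ext rfl h)
    · exact (hM'.2 _ hM.1 h).symm
  · intro Q hQ
    obtain ⟨M, hM, hmax⟩ := Finset.exists_max_image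
      (F.filter fun M => Q.1 ≤ M.1 ∧ dyadicCube n Q.1 Q.2 ⊆ dyadicCube n M.1 M.2)
      (fun M => M.1) ⟨Q, by simp [hQ]⟩
    rw [Finset.mem_filter] at hM
    refine ⟨M, Finset.mem_filter.2 ⟨hM.1, fun R hR hlt => ?_⟩, hM.2⟩
    by_contra hd
    exact hlt.not_ge (hmax R (Finset.mem_filter.2 ⟨hR, hM.2.1.trans hlt.le,
      hM.2.2.trans (dyadicCube_subset_of_not_disjoint hlt.le hd)⟩))

/-- The weighted measure of a finite family of dyadic cubes is controlled by that of a
pairwise disjoint subfamily. -/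
theorem exists_pairwiseDisjoint_sum_dyadicCube_le {n : ℕ} (μ : Measure (Fin n → ℝ)) {γ : ℝ}
    (hγ : γ < 0) (F : Finset (ℤ × (Fin n → ℤ))) :
    ∃ P ⊆ F, (P : Set (ℤ × (Fin n → ℤ))).PairwiseDisjoint (fun Q => dyadicCube n Q.1 Q.2) ∧
      ∑ Q ∈ F, ENNReal.ofReal (((2 : ℝ) ^ Q.1) ^ (-γ)) * μ (dyadicCube n Q.1 Q.2)
        ≤ ENNReal.ofReal (1 - 2 ^ γ)⁻¹ *
          ∑ Q ∈ P, ENNReal.ofReal (((2 : ℝ) ^ Q.1) ^ (-γ)) * μ (dyadicCube n Q.1 Q.2) := by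
  obtain ⟨P, hPF, hP, hcover⟩ := exists_pairwiseDisjoint_dyadicCube_cover F
  refine ⟨P, hPF, hP, ?_⟩
  calc _ ≤ ∑ Q ∈ F, ∑ M ∈ P,
        (if Q.1 ≤ M.1 ∧ dyadicCube n Q.1 Q.2 ⊆ dyadicCube n M.1 M.2 then
          ENNReal.ofReal (((2 : ℝ) ^ Q.1) ^ (-γ)) * μ (dyadicCube n Q.1 Q.2) else 0) := by
        refine Finset.sum_le_sum fun Q hQ => ?_
        obtain ⟨M, hM, hQM⟩ := hcover Q hQ
        refine le_trans ?_ (Finset.single_le_sum (fun _ _ => zero_le) hM)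
        rw [if_pos hQM]
    _ ≤ _ := by
        rw [Finset.sum_comm, Finset.mul_sum]
        exact Finset.sum_le_sum fun M _ =>
          (ENNReal.sum_le_tsum F).trans (tsum_dyadicCube_subset_le μ hγ M)

/-- for `γ < 0`, the full weak-type sum over all dyadic cubes is controlled,
uniformly in the Radon measure `μ`, the exponent `1 ≤ p < ∞` and the sequence `a`, by the
corresponding supremum over pairwise disjoint collections of dyadic cubes. -/
theorem statement4 (n : ℕ) (γ : ℝ) (hγ : γ < 0) :
    ∃ C : ℝ, 0 < C ∧
      ∀ (μ : Measure (Fin n → ℝ)), IsFiniteMeasureOnCompacts μ →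
      ∀ (p : ℝ), 1 ≤ p →
      ∀ (a : ℤ × (Fin n → ℤ) → ℝ),
      (⨆ l ∈ Set.Ioi (0 : ℝ), ENNReal.ofReal (l ^ p) *
          ∑' Q : ℤ × (Fin n → ℤ),
            if l < |a Q| then
              ENNReal.ofReal (((2 : ℝ) ^ Q.1) ^ (-γ)) * μ (dyadicCube n Q.1 Q.2) else 0)
        ≤ ENNReal.ofReal C *
          ⨆ l ∈ Set.Ioi (0 : ℝ), ENNReal.ofReal (l ^ p) *
            ⨆ (P : Set (ℤ × (Fin n → ℤ)))
              (_ : P.PairwiseDisjoint fun Q => dyadicCube n Q.1 Q.2),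
              ∑' Q : ℤ × (Fin n → ℤ),
                if Q ∈ P ∧ l < |a Q| then
                  ENNReal.ofReal (((2 : ℝ) ^ Q.1) ^ (-γ)) * μ (dyadicCube n Q.1 Q.2) else 0 := by
  have hr : (2 : ℝ) ^ γ < 1 := Real.rpow_lt_one_of_one_lt_of_neg one_lt_two hγ
  refine ⟨(1 - 2 ^ γ)⁻¹, inv_pos.2 (by linarith), fun μ _ p _ a => ?_⟩
  refine iSup₂_le fun l hl => ?_
  refine le_trans ?_ (mul_le_mul_right (le_iSup₂ l hl) _)
  rw [mul_left_comm]
  gcongr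
  rw [ENNReal.tsum_eq_iSup_sum]
  refine iSup_le fun F => ?_
  obtain ⟨P, hPF, hP, hle⟩ :=
    exists_pairwiseDisjoint_sum_dyadicCube_le μ hγ (F.filter fun Q => l < |a Q|)
  rw [← Finset.sum_filter]
  refine hle.trans ?_
  gcongr
  refine le_trans ?_ (le_iSup₂ (P : Set (ℤ × (Fin n → ℤ))) hP)
  refine le_trans (Finset.sum_le_sum fun Q hQ => ?_) (ENNReal.sum_le_tsum P)
  rw [if_pos ⟨hQ, (Finset.mem_filter.1 (hPF hQ)).2⟩]
end
end
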